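/- arXiv:1510.06379 — 2 statements merged into one kernel-verified Lean document; each statement's English description precedes it below -/
import Mathlib

section
/- Let A = Option A₀ carry the flat order, and let R, R' : Option (A × B) → Option (A × C) → Prop be relations with fail. Then (1) R ⊑ R' implies fb_a R ⊑ fb_a R' and fb_b R ⊑ fb_b R'; and (2) the instantaneous feedback decomposes point-free as InstFeedback R = fb_begin ∘ (fb_a R)* ∘ fb_b R (relational compositions). -/
/-- Relational composition. -/
def relComp {X Y Z : Type*} (r : X → Y → Prop) (r' : Y → Z → Prop) : X → Z → Prop :=
  fun x z => ∃ y, r x y ∧ r' y z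

/-- `n`-fold relational composition (`R⁰` is the equality relation). -/
def relPow {X : Type*} (R : X → X → Prop) : ℕ → X → X → Prop
  | 0 => fun x y => x = y
  | n + 1 => relComp R (relPow R n)

/-- Reflexive-transitive closure: `R* = ⋁ₙ Rⁿ`. -/
def relStar {X : Type*} (R : X → X → Prop) : X → X → Prop :=
  fun x y => ∃ n, relPow R n x y

/-- The flat order on `Option A` (with `⊥ = none`): `a ≤ b ↔ a = ⊥ ∨ a = b`. -/
def flatLE {A : Type*} (a b : Option A) : Prop := a = none ∨ a = b

/-- Strict flat order on `Option A`. -/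
def flatLT {A : Type*} (a b : Option A) : Prop := flatLE a b ∧ a ≠ b

/-- A relation with fail from `X` to `Y` (with `none` playing the role of `•`). -/
def IsRWF {X Y : Type*} (R : Option X → Option Y → Prop) : Prop :=
  ∀ y, R none y ↔ y = none

/-- Refinement of relations with fail. -/
def refinesRWF {X Y : Type*} (R R' : Option X → Option Y → Prop) : Prop :=
  ∀ x, R x none ∨ ∀ y, R' x y → R x y

/-- Instantaneous feedback of a relation with fail and unknown. -/
def InstFeedback {A B C : Type*}
    (R : Option (Option A × B) → Option (Option A × C) → Prop) :
    Option B → Option (Option A × C) → Prop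
  | none, y => y = none
  | some x, none =>
      ∃ (n : ℕ) (u : ℕ → Option A), u 0 = none ∧ R (some (u n, x)) none ∧
        ∀ i < n, flatLT (u i) (u (i + 1)) ∧ ∃ z, R (some (u i, x)) (some (u (i + 1), z))
  | some x, some (v, y) =>
      ∃ (n : ℕ) (u : ℕ → Option A), u 0 = none ∧ u n = v ∧
        R (some (v, x)) (some (v, y)) ∧
        ∀ i < n, flatLT (u i) (u (i + 1)) ∧ ∃ z, R (some (u i, x)) (some (u (i + 1), z))

/-- `fb_begin`: initialize the feedback wire to unknown. -/
def fbBegin {A B : Type*} : Option B → Option (Option A × B) → Prop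
  | none, y => y = none
  | some _, none => False
  | some x, some (u, x') => u = none ∧ x = x'

/-- `fb_a R`: one strictly increasing feedback iteration step. -/
def fbA {A B C : Type*} (R : Option (Option A × B) → Option (Option A × C) → Prop) :
    Option (Option A × B) → Option (Option A × B) → Prop
  | none, y => y = none
  | some (u, x), none => R (some (u, x)) none
  | some (u, x), some (v, x') =>
      flatLT u v ∧ x = x' ∧ ∃ y, R (some (u, x)) (some (v, y))

/-- `fb_b R`: the final, stabilized feedback step. -/
def fbB {A B C : Type*} (R : Option (Option A × B) → Option (Option A × C) → Prop) :
    Option (Option A × B) → Option (Option A × C) → Prop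
  | none, y => y = none
  | some (u, x), none => R (some (u, x)) none
  | some (u, x), some (v, y) => u = v ∧ R (some (u, x)) (some (u, y))

theorem fbA_mono {A B C : Type*} {R R' : Option (Option A × B) → Option (Option A × C) → Prop}
    (h : refinesRWF R R') : refinesRWF (fbA R) (fbA R') := by
  rintro (_ | ⟨u, x⟩)
  · exact Or.inl rfl
  · refine (h (some (u, x))).imp id fun hx => ?_
    rintro (_ | ⟨v, x'⟩)
    · exact hx none
    · rintro ⟨hlt, hxx, y, hy⟩
      exact ⟨hlt, hxx, y, hx _ hy⟩

theorem fbB_mono {A B C : Type*} {R R' : Option (Option A × B) → Option (Option A × C) → Prop}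
    (h : refinesRWF R R') : refinesRWF (fbB R) (fbB R') := by
  rintro (_ | ⟨u, x⟩)
  · exact Or.inl rfl
  · refine (h (some (u, x))).imp id fun hx => ?_
    rintro (_ | ⟨v, y⟩)
    · exact hx none
    · rintro ⟨huv, hy⟩
      exact ⟨huv, hx _ hy⟩

theorem eq_none_of_relPow_fbA_none {A B C : Type*}
    {R : Option (Option A × B) → Option (Option A × C) → Prop} {n : ℕ}
    {z : Option (Option A × B)} (h : relPow (fbA R) n none z) : z = none := by
  induction n with
  | zero => exact h.symm
  | succ n ih =>
    obtain ⟨y, hy, hz⟩ := h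
    obtain rfl : y = none := hy
    exact ih hz

/-- Non-failing iterations of `fbA R` are the increasing chains of `R`-steps. -/
theorem relPow_fbA_some_some {A B C : Type*}
    {R : Option (Option A × B) → Option (Option A × C) → Prop} {n : ℕ}
    {u₀ v : Option A} {x x' : B} :
    relPow (fbA R) n (some (u₀, x)) (some (v, x')) ↔
      x = x' ∧ ∃ u : ℕ → Option A, u 0 = u₀ ∧ u n = v ∧
        ∀ i < n, flatLT (u i) (u (i + 1)) ∧ ∃ z, R (some (u i, x)) (some (u (i + 1), z)) := by
  induction n generalizing u₀ with
  | zero =>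
    constructor
    · intro h
      obtain ⟨rfl, rfl⟩ : u₀ = v ∧ x = x' := by simpa [relPow] using h
      exact ⟨rfl, fun _ => u₀, rfl, rfl, by simp⟩
    · rintro ⟨rfl, u, rfl, rfl, -⟩
      rfl
  | succ n ih =>
    constructor
    · rintro ⟨_ | ⟨w, x''⟩, hstep, hrest⟩
      · exact absurd (eq_none_of_relPow_fbA_none hrest) (by simp)
      · obtain ⟨hlt, rfl, hz⟩ := hstep
        obtain ⟨rfl, u, rfl, rfl, hu⟩ := ih.1 hrest
        refine ⟨rfl, fun i => Nat.casesOn i u₀ u, rfl, rfl, ?_⟩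
        rintro (_ | i) hi
        · exact ⟨hlt, hz⟩
        · exact hu i (by omega)
    · rintro ⟨rfl, u, rfl, rfl, hu⟩
      obtain ⟨hlt, hz⟩ := hu 0 (by omega)
      exact ⟨some (u 1, x), ⟨hlt, rfl, hz⟩,
        ih.2 ⟨rfl, fun i => u (i + 1), rfl, rfl, fun i hi => hu (i + 1) (by omega)⟩⟩

/-- An iteration of `fbA R` fails only by reaching a state on which `R` fails. -/
theorem exists_relPow_fbA_of_fail {A B C : Type*}
    {R : Option (Option A × B) → Option (Option A × C) → Prop} {n : ℕ} {u₀ : Option A} {x : B}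
    (h : relPow (fbA R) n (some (u₀, x)) none) :
    ∃ m v, relPow (fbA R) m (some (u₀, x)) (some (v, x)) ∧ R (some (v, x)) none := by
  induction n generalizing u₀ with
  | zero => exact absurd h (by simp [relPow])
  | succ n ih =>
    obtain ⟨_ | ⟨w, x'⟩, hstep, hrest⟩ := h
    · exact ⟨0, u₀, rfl, hstep⟩
    · obtain ⟨hlt, rfl, hz⟩ := hstep
      obtain ⟨m, v, hm, hv⟩ := ih hrest
      exact ⟨m + 1, v, ⟨some (w, x), ⟨hlt, rfl, hz⟩, hm⟩, hv⟩

/-- `fb_a` and `fb_b` preserve refinement, and instantaneous feedback decomposes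
point-free as `InstFeedback R = fb_begin ∘ (fb_a R)* ∘ fb_b R`. -/
theorem instFeedback_point_free {A B C : Type*}
    (R R' : Option (Option A × B) → Option (Option A × C) → Prop)
    (hR : IsRWF R) (hR' : IsRWF R') :
    (refinesRWF R R' → refinesRWF (fbA R) (fbA R') ∧ refinesRWF (fbB R) (fbB R')) ∧
      InstFeedback R = relComp (relComp fbBegin (relStar (fbA R))) (fbB R) := by
  refine ⟨fun h => ⟨fbA_mono h, fbB_mono h⟩, ?_⟩
  funext b z
  apply propext
  rcases b with _ | x
  · constructor
    · intro hz
      exact ⟨none, ⟨none, rfl, 0, rfl⟩, hz⟩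
    · rintro ⟨q, ⟨p, hp, n, hn⟩, hz⟩
      obtain rfl : p = none := hp
      obtain rfl := eq_none_of_relPow_fbA_none hn
      exact hz
  · rcases z with _ | ⟨v, y⟩
    · constructor
      · rintro ⟨n, u, h0, hfail, hu⟩
        exact ⟨some (u n, x), ⟨some (none, x), ⟨rfl, rfl⟩, n,
          relPow_fbA_some_some.2 ⟨rfl, u, h0, rfl, hu⟩⟩, hfail⟩
      · rintro ⟨q, ⟨_ | ⟨w, x'⟩, hp, n, hn⟩, hz⟩
        · exact hp.elim
        · obtain ⟨rfl, rfl⟩ := hp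
          obtain ⟨m, v, hm, hv⟩ :
              ∃ m v, relPow (fbA R) m (some (none, x)) (some (v, x)) ∧ R (some (v, x)) none := by
            rcases q with _ | ⟨v, x'⟩
            · exact exists_relPow_fbA_of_fail hn
            · obtain rfl := (relPow_fbA_some_some.1 hn).1
              exact ⟨n, v, hn, hz⟩
          obtain ⟨-, u, h0, rfl, hu⟩ := relPow_fbA_some_some.1 hm
          exact ⟨m, u, h0, hv, hu⟩
    · constructor
      · rintro ⟨n, u, h0, rfl, hy, hu⟩
        exact ⟨some (u n, x), ⟨some (none, x), ⟨rfl, rfl⟩, n,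
          relPow_fbA_some_some.2 ⟨rfl, u, h0, rfl, hu⟩⟩, rfl, hy⟩
      · rintro ⟨_ | ⟨w', x''⟩, ⟨_ | ⟨w, x'⟩, hp, n, hn⟩, hz⟩
        · exact hp.elim
        · exact absurd hz (by simp [fbB])
        · exact hp.elim
        · obtain ⟨rfl, rfl⟩ := hp
          obtain ⟨rfl, u, h0, hun, hu⟩ := relPow_fbA_some_some.1 hn
          obtain ⟨rfl, hy⟩ := hz
          exact ⟨n, u, h0, hun, hy, hu⟩
end

section
/- Instantaneous feedback preserves refinement: if A = Option A₀ carries the flat order and R, R' : Option (A × B) → Option (A × C) → Prop are relations with fail with R ⊑ R', then InstFeedback R ⊑ InstFeedback R'. -/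
/-- If `InstFeedback R` does not fail at `x`, then `R` does not fail at the end of any chain of
`R`-steps from `⊥`, so there it admits every behaviour of a refinement `R'`. -/
theorem refinesRWF.of_chain {A B C : Type*}
    {R R' : Option (Option A × B) → Option (Option A × C) → Prop} (h : refinesRWF R R')
    {x : B} (hx : ¬ InstFeedback R (some x) none) {n : ℕ} {u : ℕ → Option A} (h0 : u 0 = none)
    (hu : ∀ i < n, flatLT (u i) (u (i + 1)) ∧ ∃ z, R (some (u i, x)) (some (u (i + 1), z)))
    {y : Option (Option A × C)} (hy : R' (some (u n, x)) y) : R (some (u n, x)) y :=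
  (h (some (u n, x))).elim (fun hf => absurd ⟨n, u, h0, hf, hu⟩ hx) fun hs => hs y hy

/-- If `InstFeedback R` does not fail at `x`, then every chain of `R'`-steps from `⊥` is a chain
of `R`-steps, for any refinement `R'` of `R`. -/
theorem refinesRWF.chain {A B C : Type*}
    {R R' : Option (Option A × B) → Option (Option A × C) → Prop} (h : refinesRWF R R')
    {x : B} (hx : ¬ InstFeedback R (some x) none) {n : ℕ} {u : ℕ → Option A} (h0 : u 0 = none)
    (hu : ∀ i < n, flatLT (u i) (u (i + 1)) ∧ ∃ z, R' (some (u i, x)) (some (u (i + 1), z))) :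
    ∀ i < n, flatLT (u i) (u (i + 1)) ∧ ∃ z, R (some (u i, x)) (some (u (i + 1), z)) := by
  intro i
  induction i using Nat.strong_induction_on with
  | _ i ih =>
    intro hi
    obtain ⟨hlt, z, hz⟩ := hu i hi
    exact ⟨hlt, z, h.of_chain hx h0 (fun j hj => ih j hj (hj.trans hi)) hz⟩

/-- Instantaneous feedback preserves refinement. -/
theorem instFeedback_preserves_refinement {A B C : Type*}
    (R R' : Option (Option A × B) → Option (Option A × C) → Prop)
    (hR : IsRWF R) (hR' : IsRWF R') (h : refinesRWF R R') :
    refinesRWF (InstFeedback R) (InstFeedback R') := by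
  rintro (_ | x)
  · exact Or.inl rfl
  refine or_iff_not_imp_left.2 fun hx => ?_
  rintro (_ | ⟨v, y⟩)
  · rintro ⟨n, u, h0, hf, hu⟩
    have hc := h.chain hx h0 hu
    exact ⟨n, u, h0, h.of_chain hx h0 hc hf, hc⟩
  · rintro ⟨n, u, h0, rfl, hy, hu⟩
    have hc := h.chain hx h0 hu
    exact ⟨n, u, h0, rfl, h.of_chain hx h0 hc hy, hc⟩
end
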